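/- Let n be even, n ≥ 6, let S ⊆ F_{2^n} be any subset, and define f(x) = x^{-1} + δ_S(x) (with 0^{-1} = 0 and δ_S the {0,1}-valued characteristic function of S). Then the nonlinearity of f satisfies NL(f) ≥ 2^{n-1} − 2^{n/2} − |S|. -/

import Mathlib

open scoped Classical
open Polynomial in
lemma kl_step {F : Type*} [Field F] [CharP F 2] (c : F) (hc : c ≠ 0) (P' Q' P Q : F[X])
    (h' : IsCoprime P' Q') (h : IsCoprime P Q)
    (hB : (P^2 + X^2*Q^2) * P'^2 + X*P*Q*P'*Q' + (X^2*P^2 + C c^2*Q^2)*Q'^2 = 0) :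
    ∃ P'' Q'' : F[X], IsCoprime P'' Q'' ∧
      (P^2 + X^2*Q^2) * P''^2 + X*P*Q*P''*Q'' + (X^2*P^2 + C c^2*Q^2)*Q''^2 = 0 ∧
      max P'.natDegree Q'.natDegree + max P''.natDegree Q''.natDegree
        = 2 * max P.natDegree Q.natDegree + 2 := by
  have h2 : (2 : F[X]) = 0 := CharTwo.two_eq_zero
  obtain ⟨P'', Q'', hα, hβ, hγ⟩ : ∃ P'' Q'' : F[X], P^2 + X^2*Q^2 = Q' * Q'' ∧
      X*P*Q = Q''*P' + P''*Q' ∧ X^2*P^2 + C c^2*Q^2 = P' * P'' := by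
    generalize P^2 + X^2*Q^2 = α at *
    generalize X^2*P^2 + C c^2*Q^2 = γ at *
    generalize hb : X*P*Q = β at *
    have hQ : Q' ∣ α := by
      have : Q' ∣ α * P'^2 := ⟨-(β*P' + γ*Q'), by linear_combination hB⟩
      exact (h'.symm.pow_right).dvd_of_dvd_mul_right this
    have hP : P' ∣ γ := by
      have : P' ∣ γ * Q'^2 := ⟨-(α*P' + β*Q'), by linear_combination hB⟩
      exact (h'.pow_right).dvd_of_dvd_mul_right this
    by_cases hQ0 : Q' = 0
    · subst hQ0
      obtain ⟨u, hu⟩ := (isCoprime_zero_right.1 h').exists_right_inv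
      have : α = 0 := by simpa using hQ
      refine ⟨γ*u, β*u, by simp [this], by linear_combination -β*hu, by linear_combination -γ*hu⟩
    by_cases hP0 : P' = 0
    · subst hP0
      obtain ⟨u, hu⟩ := (isCoprime_zero_left.1 h').exists_right_inv
      have : γ = 0 := by simpa using hP
      refine ⟨β*u, α*u, by linear_combination -α*hu, by linear_combination -β*hu, by simp [this]⟩
    obtain ⟨Q'', rfl⟩ := hQ
    obtain ⟨P'', rfl⟩ := hP
    refine ⟨P'', Q'', rfl, ?_, rfl⟩
    have : (P' * Q') * (β - (Q''*P' + P''*Q')) = 0 := by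
      linear_combination hB - (P' * Q') * (Q''*P' + P''*Q') * h2
    rcases mul_eq_zero.1 this with h0 | h0
    · simp [hP0, hQ0] at h0
    · exact sub_eq_zero.1 h0
  have hα2 : P^2 + X^2*Q^2 = (P + X*Q)^2 := by linear_combination -P*X*Q*h2
  have hγ2 : X^2*P^2 + C c^2*Q^2 = (X*P + C c*Q)^2 := by linear_combination -P*X*Q*C c*h2
  have hCc : IsUnit (C c : F[X]) := by simpa using hc
  have hcop : ∀ z : F[X], Prime z → z ∣ P + X*Q → z ∣ X*P + C c*Q → z ∣ X*P*Q → False := by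
    intro z hz h1 h2 h3
    have hPQ : z ∣ P → z ∣ Q → False := fun a b => hz.not_isUnit (h.isUnit_of_dvd' a b)
    rcases hz.dvd_or_dvd h3 with h4 | h4
    · rcases hz.dvd_or_dvd h4 with h4 | h4
      · have hp : z ∣ P := (dvd_add_left (h4.mul_right Q)).1 h1
        have hq : z ∣ C c * Q := (dvd_add_right (h4.mul_right P)).1 h2
        exact hPQ hp (hCc.dvd_mul_left.1 hq)
      · have hq : z ∣ C c * Q := (dvd_add_right (h4.mul_left X)).1 h2
        exact hPQ h4 (hCc.dvd_mul_left.1 hq)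
    · exact hPQ ((dvd_add_left (h4.mul_left X)).1 h1) h4
  have hlead : ∀ A B : F[X], IsCoprime A B → ¬ (A.coeff (max A.natDegree B.natDegree) = 0 ∧
      B.coeff (max A.natDegree B.natDegree) = 0) := by
    rintro A B hAB ⟨h1, h3⟩
    rcases le_total A.natDegree B.natDegree with hle | hle
    · rw [max_eq_right hle] at *
      have : B = 0 := by simpa using h3
      subst this
      have : A = 0 := by
        have h4 : A.natDegree = 0 := by simpa using hle
        rw [natDegree_zero, ← h4] at h1
        simpa using h1
      subst this
      exact not_isCoprime_zero_zero hAB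
    · rw [max_eq_left hle] at *
      have : A = 0 := by simpa using h1
      subst this
      have : B = 0 := by
        have h4 : B.natDegree = 0 := by simpa using hle
        rw [natDegree_zero, ← h4] at h3
        simpa using h3
      subst this
      exact not_isCoprime_zero_zero hAB
  have hcop'' : IsCoprime P'' Q'' := by
    apply isCoprime_of_prime_dvd
    · rintro ⟨rfl, rfl⟩
      rw [mul_zero, hα2] at hα
      rw [mul_zero, hγ2] at hγ
      refine hcop X prime_X ?_ ?_ ?_
      · rw [pow_eq_zero_iff (by norm_num)] at hα; simp [hα]
      · rw [pow_eq_zero_iff (by norm_num)] at hγ; simp [hγ]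
      · simp [hβ]
    · intro z hz h1 h3
      refine hcop z hz ?_ ?_ ?_
      · exact hz.dvd_of_dvd_pow (n := 2) (by rw [← hα2, hα]; exact h3.mul_left _)
      · exact hz.dvd_of_dvd_pow (n := 2) (by rw [← hγ2, hγ]; exact h1.mul_left _)
      · rw [hβ]; exact dvd_add (h3.mul_right _) (h1.mul_right _)
  refine ⟨P'', Q'', hcop'', ?_, ?_⟩
  · rw [hα, hβ, hγ]; linear_combination (Q'*Q''*P''^2 + P'*P''*Q''^2)*h2
  set d := max P.natDegree Q.natDegree with hd
  set d' := max P'.natDegree Q'.natDegree with hd'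
  set d'' := max P''.natDegree Q''.natDegree with hd''
  have eP : P.natDegree ≤ d := le_max_left _ _
  have eQ : Q.natDegree ≤ d := le_max_right _ _
  have eP' : P'.natDegree ≤ d' := le_max_left _ _
  have eQ' : Q'.natDegree ≤ d' := le_max_right _ _
  have eP'' : P''.natDegree ≤ d'' := le_max_left _ _
  have eQ'' : Q''.natDegree ≤ d'' := le_max_right _ _
  have l1 : (P + X*Q).natDegree ≤ d + 1 := by
    refine natDegree_add_le_of_degree_le (by omega) ?_
    refine natDegree_mul_le.trans ?_
    rw [natDegree_X]; omega
  have l2 : (X*P + C c*Q).natDegree ≤ d + 1 := by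
    refine natDegree_add_le_of_degree_le ?_ ((natDegree_C_mul_le _ _).trans (by omega))
    refine natDegree_mul_le.trans ?_
    rw [natDegree_X]; omega
  have l3 : (X*P*Q).natDegree ≤ 2*d + 2 := by
    refine natDegree_mul_le.trans ?_
    have : (X*P).natDegree ≤ 1 + P.natDegree := natDegree_mul_le.trans (by rw [natDegree_X])
    omega
  have m1 : (P^2 + X^2*Q^2).natDegree = 2 * (P + X*Q).natDegree := by rw [hα2, natDegree_pow]
  have m2 : (X^2*P^2 + C c^2*Q^2).natDegree = 2 * (X*P + C c*Q).natDegree := by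
    rw [hγ2, natDegree_pow]
  have lead := hlead P Q h
  have lead' := hlead P' Q' h'
  have lead'' := hlead P'' Q'' hcop''
  rw [← hd] at lead
  rw [← hd'] at lead'
  rw [← hd''] at lead''
  have n1 : (P^2 + X^2*Q^2).natDegree ≤ d' + d'' := by
    rw [hα]; exact natDegree_mul_le.trans (by omega)
  have n2 : (X^2*P^2 + C c^2*Q^2).natDegree ≤ d' + d'' := by
    rw [hγ]; exact natDegree_mul_le.trans (by omega)
  apply le_antisymm
  · by_contra hlt
    push Not at hlt
    have c1 : (Q' * Q'').coeff (d' + d'') = 0 := by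
      rw [← hα]; exact coeff_eq_zero_of_natDegree_lt (by omega)
    have c2 : (P' * P'').coeff (d' + d'') = 0 := by
      rw [← hγ]; exact coeff_eq_zero_of_natDegree_lt (by omega)
    have c3 : (P' * Q'' + Q' * P'').coeff (d' + d'') = 0 := by
      rw [mul_comm P', mul_comm Q', ← hβ]; exact coeff_eq_zero_of_natDegree_lt (by omega)
    rw [coeff_mul_add_eq_of_natDegree_le eQ' eQ''] at c1
    rw [coeff_mul_add_eq_of_natDegree_le eP' eP''] at c2
    rw [coeff_add, coeff_mul_add_eq_of_natDegree_le eP' eQ'',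
      coeff_mul_add_eq_of_natDegree_le eQ' eP''] at c3
    grind
  · have hor : d + 1 ≤ (P + X*Q).natDegree ∨ d + 1 ≤ (X*P + C c*Q).natDegree := by
      by_cases hp : P.coeff d = 0
      · left
        apply le_natDegree_of_ne_zero
        rw [coeff_add, coeff_X_mul, coeff_eq_zero_of_natDegree_lt (p := P) (by omega)]
        intro hq
        exact lead ⟨hp, by simpa using hq⟩
      · right
        apply le_natDegree_of_ne_zero
        rw [coeff_add, coeff_X_mul, coeff_C_mul, coeff_eq_zero_of_natDegree_lt (p := Q) (by omega)]
        simpa using hp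
    omega

open Polynomial in
lemma kl_iter {F : Type*} [Field F] [CharP F 2] (c : F) (hc : c ≠ 0) (P' Q' P Q : F[X])
    (h' : IsCoprime P' Q') (h : IsCoprime P Q)
    (hB : (P^2 + X^2*Q^2) * P'^2 + X*P*Q*P'*Q' + (X^2*P^2 + C c^2*Q^2)*Q'^2 = 0) (k : ℕ) :
    0 ≤ ((max P'.natDegree Q'.natDegree : ℕ) : ℤ) +
      k * (((max P.natDegree Q.natDegree : ℕ) : ℤ) - (max P'.natDegree Q'.natDegree : ℕ))
      + k * (k - 1) := by
  induction k generalizing P' Q' P Q with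
  | zero => simp
  | succ k ih =>
    obtain ⟨P'', Q'', h'', hB'', hd⟩ := kl_step c hc P' Q' P Q h' h hB
    have := ih P Q P'' Q'' h h'' (by linear_combination hB'')
    have hd2 : ((max P'.natDegree Q'.natDegree : ℕ) : ℤ) + (max P''.natDegree Q''.natDegree : ℕ)
        = 2 * (max P.natDegree Q.natDegree : ℕ) + 2 := by exact_mod_cast hd
    generalize ((max P''.natDegree Q''.natDegree : ℕ) : ℤ) = e'' at *
    generalize ((max P'.natDegree Q'.natDegree : ℕ) : ℤ) = e' at *
    generalize ((max P.natDegree Q.natDegree : ℕ) : ℤ) = e at *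
    have : e'' = 2*e+2-e' := by linarith
    subst this
    push_cast
    nlinarith

lemma kl_tr_sq {F : Type*} [Field F] [Fintype F] [CharP F 2] {n : ℕ}
    (hcard : Fintype.card F = 2 ^ n) (z : F) :
    (∑ i ∈ Finset.range n, z ^ 2 ^ i) = 0 ∨ (∑ i ∈ Finset.range n, z ^ 2 ^ i) = 1 := by
  have h1 : (∑ i ∈ Finset.range n, z ^ 2 ^ i) ^ 2 = ∑ i ∈ Finset.range n, z ^ 2 ^ i := by
    rw [CharTwo.sum_sq]
    have : ∀ i ∈ Finset.range n, (z ^ 2 ^ i) ^ 2 = z ^ 2 ^ (i+1) := by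
      intro i _; rw [← pow_mul, ← pow_succ]
    rw [Finset.sum_congr rfl this]
    have h3 := Finset.sum_range_succ (fun i => z ^ 2 ^ i) n
    have h4 := Finset.sum_range_succ' (fun i => z ^ 2 ^ i) n
    rw [h3] at h4
    have : z ^ 2 ^ n = z := by rw [← hcard]; exact FiniteField.pow_card z
    simp only [this, pow_zero, pow_one] at h4
    exact (add_right_cancel h4).symm
  have : (∑ i ∈ Finset.range n, z ^ 2 ^ i) * ((∑ i ∈ Finset.range n, z ^ 2 ^ i) - 1) = 0 := by
    linear_combination h1
  rcases mul_eq_zero.1 this with h | h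
  · exact Or.inl h
  · exact Or.inr (sub_eq_zero.1 h)

lemma kl_tr_add {F : Type*} [Field F] [CharP F 2] (n : ℕ) (z w : F) :
    (∑ i ∈ Finset.range n, (z + w) ^ 2 ^ i) =
      (∑ i ∈ Finset.range n, z ^ 2 ^ i) + (∑ i ∈ Finset.range n, w ^ 2 ^ i) := by
  rw [← Finset.sum_add_distrib]
  exact Finset.sum_congr rfl fun i _ => add_pow_char_pow ..

open Polynomial in
lemma kl_exists_tr_one {F : Type*} [Field F] [Fintype F] [CharP F 2] {n : ℕ} (hn : 1 ≤ n)
    (hcard : Fintype.card F = 2 ^ n) : ∃ z : F, (∑ i ∈ Finset.range n, z ^ 2 ^ i) = 1 := by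
  by_contra hcon
  push Not at hcon
  have h0 : ∀ z : F, (∑ i ∈ Finset.range n, z ^ 2 ^ i) = 0 := fun z =>
    (kl_tr_sq hcard z).resolve_right (hcon z)
  set p : F[X] := ∑ i ∈ Finset.range n, X ^ 2 ^ i with hp
  have hdeg : p.natDegree ≤ 2 ^ (n-1) := by
    apply natDegree_sum_le_of_forall_le
    intro i hi
    rw [natDegree_X_pow]
    exact Nat.pow_le_pow_right (by norm_num) (by have := Finset.mem_range.1 hi; omega)
  have hp0 : p = 0 := by
    apply eq_zero_of_natDegree_lt_card_of_eval_eq_zero p (f := (id : F → F)) Function.injective_id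
    · intro z; simp [hp, eval_finsetSum, h0]
    · rw [hcard]
      exact lt_of_le_of_lt hdeg (Nat.pow_lt_pow_right (by norm_num) (by omega))
  have : p.coeff 1 = 1 := by
    rw [hp, finsetSum_coeff]
    rw [Finset.sum_eq_single 0]
    · simp
    · intro i _ hi
      rw [coeff_X_pow, if_neg]
      intro h
      have := Nat.one_lt_two_pow hi
      omega
    · intro h; simp at h; omega
  rw [hp0] at this
  simp at this

open Polynomial in
lemma kl_main {F : Type*} [Field F] [Fintype F] [CharP F 2] {m : ℕ} (hm : 1 ≤ m)
    (hcard : Fintype.card F = 2 ^ (2*m)) (c : F) (hc : c ≠ 0) (M : ℕ)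
    (hM : M = (Finset.univ.filter fun x : F =>
      x ≠ 0 ∧ (∑ i ∈ Finset.range (2*m), (x + c * x⁻¹) ^ 2 ^ i) ≠ 0).card) :
    |(2 * M : ℤ) + 1 - 2 ^ (2*m)| ≤ 2 * 2 ^ m := by
  have h2 : (2 : F[X]) = 0 := CharTwo.two_eq_zero
  set n := 2*m with hnm
  set Tr : F → F := fun z => ∑ i ∈ Finset.range n, z ^ 2 ^ i with hTr
  set S1 := Finset.univ.filter fun x : F => x ≠ 0 ∧ Tr (x + c * x⁻¹) ≠ 0 with hS1
  set S0 := Finset.univ.filter fun x : F => x ≠ 0 ∧ Tr (x + c * x⁻¹) = 0 with hS0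
  set M0 : F[X] := ∏ x ∈ S0, (X - C x) with hM0
  set M1 : F[X] := ∏ x ∈ S1, (X - C x) with hM1
  obtain ⟨h, hh⟩ : ∃ h, h = 2 ^ (n-1) := ⟨_, rfl⟩
  have hh2 : 2 * h = 2 ^ n := by
    rw [hh, ← pow_succ']; congr 1; omega
  have hhpos : 0 < h := by rw [hh]; positivity
  set T : F[X] := X ^ 2 ^ n with hT
  have hTh : T = X^h * X^h := by rw [hT, ← pow_add]; congr 1; omega
  have hdisj : Disjoint S0 S1 := by
    rw [Finset.disjoint_left]; intro x hx hx1
    simp [hS0, hS1] at hx hx1; exact hx1.2 hx.2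
  have hd0 : (0:F) ∉ S0 ∪ S1 := by simp [hS0, hS1]
  have huniv : (Finset.univ : Finset F) = insert 0 (S0 ∪ S1) := by
    ext x; simp [hS0, hS1]; tauto
  have hR1 : X * (M0 * M1) = T - X := by
    have e1 : (∏ x : F, (X - C x)) = X * (M0 * M1) := by
      rw [huniv, Finset.prod_insert hd0, Finset.prod_union hdisj]; simp [hM0, hM1]
    rw [← e1]
    have hcard1 : 1 < Fintype.card F := Fintype.one_lt_card
    have := prod_multiset_X_sub_C_of_monic_of_roots_card_eq
      (p := (X ^ Fintype.card F - X : F[X])) (monic_X_pow_sub (by rw [degree_X]; exact_mod_cast hcard1)) (by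
        rw [FiniteField.roots_X_pow_card_sub_X, FiniteField.X_pow_card_sub_X_natDegree_eq _ hcard1]
        simp)
    rw [FiniteField.roots_X_pow_card_sub_X, hcard] at this
    exact this
  have hR1' : X * (M0 * M1) = T + X := by linear_combination hR1 - X * h2
  set G : F[X] := ∑ i ∈ Finset.range n, (X^2 + C c) ^ 2 ^ i * X ^ (h - 2^i) with hG
  have hle : ∀ i ∈ Finset.range n, 2 ^ i ≤ h := by
    intro i hi
    rw [hh]; exact Nat.pow_le_pow_right (by norm_num) (by have := Finset.mem_range.1 hi; omega)
  have hGev : ∀ x : F, x ≠ 0 → G.eval x = x ^ h * Tr (x + c * x⁻¹) := by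
    intro x hx
    rw [hG, eval_finsetSum, hTr, Finset.mul_sum]
    refine Finset.sum_congr rfl fun i hi => ?_
    have e : x^2 + c = x * (x + c * x⁻¹) := by field_simp
    have e2 : x ^ h = x ^ 2^i * x ^ (h - 2^i) := by rw [← pow_add, Nat.add_sub_cancel' (hle i hi)]
    simp only [eval_mul, eval_pow, eval_add, eval_X, eval_C]
    rw [e, mul_pow, e2]; ring
  have hG0 : G.eval 0 = c ^ h := by
    rw [hG, eval_finsetSum, Finset.sum_eq_single (n-1)]
    · simp [← hh]
    · intro i hi hi2
      have : 2^i < h := by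
        rw [hh]; exact Nat.pow_lt_pow_right (by norm_num)
          (by have := Finset.mem_range.1 hi; omega)
      have : h - 2^i ≠ 0 := by omega
      simp [this]
    · intro h; simp at h; omega
  have hR2 : X * (G^2 + X^h * G) = (T + X) * (X * T + C c) := by
    have e1 : G^2 = ∑ i ∈ Finset.range n, (X^2 + C c) ^ 2 ^ (i+1) * X ^ (2*h - 2^(i+1)) := by
      rw [hG, CharTwo.sum_sq]
      refine Finset.sum_congr rfl fun i hi => ?_
      rw [mul_pow, ← pow_mul, ← pow_mul, ← pow_succ]
      congr 2; rw [pow_succ]; omega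
    have e2 : X^h * G = ∑ i ∈ Finset.range n, (X^2 + C c) ^ 2 ^ i * X ^ (2*h - 2^i) := by
      rw [hG, Finset.mul_sum]
      refine Finset.sum_congr rfl fun i hi => ?_
      have := hle i hi
      have e : 2*h - 2^i = h + (h - 2^i) := by omega
      rw [e, pow_add]; ring
    have h3 := Finset.sum_range_succ
      (fun i => (X^2 + C c : F[X]) ^ 2 ^ i * X ^ (2*h - 2^i)) n
    have h4 := Finset.sum_range_succ'
      (fun i => (X^2 + C c : F[X]) ^ 2 ^ i * X ^ (2*h - 2^i)) n
    rw [← e2] at h3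
    rw [← e1, h3] at h4
    have e3 : (X^2 + C c : F[X]) ^ 2 ^ n = T^2 + C c := by
      rw [add_pow_char_pow, ← C_pow, ← hcard, FiniteField.pow_card, hcard, hT]
      ring
    have e4 : X * X ^ (2*h - 1) = T := by
      rw [← pow_succ', hT]; congr 1; omega
    rw [hh2] at h4
    simp only [Nat.sub_self, pow_zero, mul_one, pow_one, e3] at h4
    rw [← hh2] at h4
    linear_combination (-X) * h4 + (X^2 + C c) * e4 + (X * X^h * G - X * X^(2*h-1) * C c - X^3 * X^(2*h-1)) * h2
  have hM0d : M0.natDegree = S0.card := by rw [hM0]; exact natDegree_finsetProd_X_sub_C_eq_card _ _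
  have hM1d : M1.natDegree = S1.card := by rw [hM1]; exact natDegree_finsetProd_X_sub_C_eq_card _ _
  have hM0m : M0.Monic := monic_prod_X_sub_C _ _
  have hM1m : M1.Monic := monic_prod_X_sub_C _ _
  have hcardS : 1 + (S0.card + S1.card) = 2 ^ n := by
    rw [← hcard, ← Finset.card_univ, huniv, Finset.card_insert_of_notMem hd0,
      Finset.card_union_of_disjoint hdisj, add_comm]
  have hM0G : M0 ∣ G := by
    apply Finset.prod_dvd_of_coprime
    · intro x _ y _ hxy
      exact pairwise_coprime_X_sub_C Function.injective_id hxy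
    · intro x hx
      simp only [hS0, Finset.mem_filter, Finset.mem_univ, true_and] at hx
      rw [dvd_iff_isRoot, IsRoot.def, hGev x hx.1, hx.2, mul_zero]
  obtain ⟨W, hW⟩ := hM0G
  have hR3 : M0 * W^2 + X^h * W = M1 * (X * T + C c) := by
    have hne : X * M0 ≠ 0 := mul_ne_zero X_ne_zero hM0m.ne_zero
    apply mul_left_cancel₀ hne
    rw [hW] at hR2
    linear_combination hR2 - (X * T + C c) * hR1'
  have hGne : G ≠ 0 := by
    intro h0; rw [h0] at hG0
    simp at hG0
    exact pow_ne_zero h hc hG0.symm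
  have hGd : G.natDegree = 2 ^ n := by
    have e1 : X * (G * (G + X^h)) = (X * (M0 * M1)) * (X ^ (2^n+1) + C c) := by
      rw [hR1', pow_succ']; linear_combination hR2
    have hne : (X * (M0 * M1)) * (X ^ (2^n+1) + C c) ≠ 0 :=
      ((monic_X.mul (hM0m.mul hM1m)).mul (monic_X_pow_add_C c (by omega))).ne_zero
    have d1 : ((X * (M0 * M1)) * (X ^ (2^n+1) + C c)).natDegree = 2^n + (2^n + 1) := by
      rw [(monic_X.mul (hM0m.mul hM1m)).natDegree_mul (monic_X_pow_add_C c (by omega)),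
        monic_X.natDegree_mul (hM0m.mul hM1m), hM0m.natDegree_mul hM1m, natDegree_X, hM0d, hM1d,
        natDegree_X_pow_add_C, hcardS]
    rw [← e1] at d1 hne
    have n1 := right_ne_zero_of_mul hne
    rw [natDegree_mul X_ne_zero n1, natDegree_mul hGne (right_ne_zero_of_mul n1), natDegree_X] at d1
    by_cases hlt : h < G.natDegree
    · rw [natDegree_add_eq_left_of_natDegree_lt (by rw [natDegree_X_pow]; exact hlt)] at d1
      omega
    · have : (G + X^h).natDegree ≤ h := natDegree_add_le_of_degree_le (by omega) (by simp)
      omega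
  have hWne : W ≠ 0 := by rintro rfl; simp at hW; exact hGne hW
  have hWd : W.natDegree = S1.card + 1 := by
    rw [hW, natDegree_mul hM0m.ne_zero hWne, hM0d] at hGd
    omega
  have hcop : IsCoprime (W^2) (X * M1^2) := by
    apply IsCoprime.pow_left
    apply IsCoprime.mul_right
    · apply IsCoprime.symm
      rw [irreducible_X.coprime_iff_not_dvd, X_dvd_iff, coeff_zero_eq_eval_zero]
      intro h0
      rw [hW, eval_mul, h0, mul_zero] at hG0
      exact pow_ne_zero _ hc hG0.symm
    · apply IsCoprime.pow_right
      apply IsCoprime.prod_right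
      intro x hx
      simp only [hS1, Finset.mem_filter, Finset.mem_univ, true_and] at hx
      apply IsCoprime.symm
      rw [(irreducible_X_sub_C x).coprime_iff_not_dvd, dvd_iff_isRoot, IsRoot.def]
      intro h0
      have := hGev x hx.1
      rw [hW, eval_mul, h0, mul_zero] at this
      exact mul_ne_zero (pow_ne_zero _ hx.1) hx.2 this.symm
  have s1 : M1^2 * (X^2*T^2 + C c^2) = M0^2*W^4 + T*W^2 := by
    linear_combination -(M0 * W^2 + X^h * W + M1 * (X * T + C c)) * hR3
      + (M0*W^3*X^h - M1^2*X*T*C c) * h2 - W^2 * hTh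
  have s2 : T^2 + X^2 = X^2*M0^2*M1^2 := by
    linear_combination -(X*(M0*M1) + T + X) * hR1' - T * X * h2
  have hB : ((W^2)^2 + X^2*(X*M1^2)^2) * T^2 + X*(W^2)*(X*M1^2)*T*1
      + (X^2*(W^2)^2 + C c^2*(X*M1^2)^2)*1^2 = 0 := by
    linear_combination W^4 * s2 + X^2*M1^2*s1 + (W^4*X^2*M0^2*M1^2 + X^2*M1^2*W^2*T)*h2
  have D1 : max T.natDegree (1 : F[X]).natDegree = 2^n := by
    rw [hT, natDegree_X_pow, natDegree_one]; simp
  have D2 : max (W^2).natDegree (X*M1^2).natDegree = 2*S1.card + 2 := by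
    rw [natDegree_pow, hWd, monic_X.natDegree_mul (hM1m.pow 2), natDegree_X, natDegree_pow, hM1d]
    omega
  have I1 := kl_iter c hc T 1 (W^2) (X*M1^2) isCoprime_one_right hcop hB (2^m)
  have I2 := kl_iter c hc (W^2) (X*M1^2) T 1 hcop isCoprime_one_right
    (by linear_combination hB) (2^m+1)
  rw [D1, D2, ← hM] at I1 I2
  have hq : (2:ℤ)^n = 2^m * 2^m := by rw [hnm, two_mul, pow_add]
  push_cast at I1 I2
  rw [hq] at I1 I2 ⊢
  have hr : (0:ℤ) < 2^m := by positivity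
  generalize (2:ℤ)^m = r at *
  rw [abs_le]
  constructor
  · have : 0 ≤ r * (2*r + (2*M+1-r*r)) := by linarith
    have := nonneg_of_mul_nonneg_right this hr
    linarith
  · have : 0 ≤ r * (2*r - (2*M+1-r*r)) := by linarith
    have := nonneg_of_mul_nonneg_right this hr
    linarith

lemma kl_sum {F : Type*} [Field F] [Fintype F] [CharP F 2] {m : ℕ} (hm : 1 ≤ m)
    (hcard : Fintype.card F = 2 ^ (2*m)) (a b : F) (hb : b ≠ 0) :
    |∑ x : F, (if (∑ i ∈ Finset.range (2*m), (a * x + b * x⁻¹) ^ 2 ^ i) = 0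
              then (1 : ℝ) else -1)| ≤ 2 * 2 ^ m := by
  by_cases ha : a = 0
  · subst ha
    simp only [zero_mul, zero_add]
    set g : F → ℝ := fun z => if (∑ i ∈ Finset.range (2*m), z ^ 2 ^ i) = 0
              then (1 : ℝ) else -1 with hg
    have e1 : ∑ x : F, g (b * x⁻¹) = ∑ x : F, g x := by
      clear_value g
      exact Function.Bijective.sum_comp (e := fun x => b * x⁻¹)
        ((mulLeft_bijective₀ b hb).comp inv_involutive.bijective) g
    obtain ⟨z, hz⟩ := kl_exists_tr_one (n := 2*m) (by omega) hcard
    have e2 : ∑ x : F, g (x + z) = ∑ x : F, g x := by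
      clear_value g
      exact Equiv.sum_comp (Equiv.addRight z) g
    have e3 : ∀ x, g (x + z) = - g x := by
      intro x
      simp only [hg, kl_tr_add, hz]
      rcases kl_tr_sq hcard x with h | h <;> rw [h]
      · simp
      · rw [CharTwo.add_self_eq_zero]; simp
    have e4 : ∑ x : F, g x = 0 := by
      simp only [e3, Finset.sum_neg_distrib] at e2
      linarith
    change |∑ x : F, g (b * x⁻¹)| ≤ _
    rw [e1, e4, abs_zero]; positivity
  · set g : F → ℝ := fun z => if (∑ i ∈ Finset.range (2*m), (z + (a*b) * z⁻¹) ^ 2 ^ i) = 0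
              then (1 : ℝ) else -1 with hg
    have e1 : ∑ x : F, g (a * x) = ∑ x : F, g x := by
      clear_value g
      exact Function.Bijective.sum_comp (e := fun x => a * x) (mulLeft_bijective₀ a ha) g
    have e2 : ∀ x : F, (if (∑ i ∈ Finset.range (2*m), (a * x + b * x⁻¹) ^ 2 ^ i) = 0
              then (1 : ℝ) else -1) = g (a * x) := by
      intro x
      have : a * b * (a * x)⁻¹ = b * x⁻¹ := by rw [mul_inv]; field_simp
      simp only [hg, this]
    simp only [e2]
    rw [e1]
    obtain ⟨M, hM⟩ : ∃ M, M = (Finset.univ.filter fun x : F =>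
      x ≠ 0 ∧ (∑ i ∈ Finset.range (2*m), (x + (a*b) * x⁻¹) ^ 2 ^ i) ≠ 0).card := ⟨_, rfl⟩
    have key := kl_main hm hcard (a*b) (mul_ne_zero ha hb) M hM
    have e3 : ∑ x : F, g x = ((2 ^ (2*m) - 2 * M : ℤ) : ℝ) := by
      have : ∀ x, g x = 1 - 2 * (if (x ≠ 0 ∧
          (∑ i ∈ Finset.range (2*m), (x + (a*b) * x⁻¹) ^ 2 ^ i) ≠ 0) then (1:ℝ) else 0) := by
        intro x
        by_cases hx : x = 0
        · subst hx; simp [hg]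
        · by_cases h : (∑ i ∈ Finset.range (2*m), (x + (a*b) * x⁻¹) ^ 2 ^ i) = 0
          · simp [hg, h]
          · simp [hg, h, hx]; norm_num
      rw [Finset.sum_congr rfl fun x _ => this x, Finset.sum_sub_distrib, ← Finset.mul_sum,
        Finset.sum_boole, ← hM]
      simp [hcard]
    rw [e3, ← Int.cast_abs]
    have hpar : (2:ℤ)^(2*m) = 2 * 2^(2*m-1) := by rw [← pow_succ']; congr 1; omega
    have : |(2 ^ (2*m) - 2 * M : ℤ)| ≤ 2 * 2^m := by
      rw [hpar] at key ⊢
      generalize (2:ℤ)^(2*m-1) = u at *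
      generalize (2:ℤ)^m = r at *
      rw [abs_le] at *
      omega
    exact_mod_cast this


/-- the nonlinearity of `f(x) = x⁻¹ + δ_S(x)` on `F_{2^n}` (n even,
`n ≥ 6`) satisfies `NL(f) ≥ 2^(n-1) - 2^(n/2) - |S|`.  Since
`NL(f) = 2^(n-1) - (1/2) · max_{a, b ≠ 0} |f^W(a,b)|`, this is equivalent to the
bound below holding for every `a` and every `b ≠ 0`. -/
theorem stmt19 {F : Type*} [Field F] [Fintype F] {n : ℕ}
    (hn : 6 ≤ n) (hne : Even n) (hcard : Fintype.card F = 2 ^ n)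
    (S : Set F) (f : F → F)
    (hf : ∀ x, f x = x⁻¹ + (if x ∈ S then (1 : F) else 0)) :
    ∀ a b : F, b ≠ 0 →
      (2 : ℝ) ^ (n - 1) - 2 ^ (n / 2) - S.ncard ≤
        (2 : ℝ) ^ (n - 1) - (1 / 2) *
          |∑ x : F, (if (∑ i ∈ Finset.range n, (a * x + b * f x) ^ 2 ^ i) = 0
              then (1 : ℝ) else -1)| := by
  intro a b hb
  have : Fact (Nat.Prime 2) := ⟨Nat.prime_two⟩
  have : CharP F 2 := charP_of_card_eq_prime_pow hcard
  obtain ⟨m, hm⟩ := hne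
  have hm2 : n = 2*m := by omega
  subst hm2
  have hK := kl_sum (by omega) hcard a b hb
  have hdiv : 2 * m / 2 = m := by omega
  rw [hdiv]
  set g : F → ℝ := fun z => if (∑ i ∈ Finset.range (2*m), z ^ 2 ^ i) = 0
              then (1 : ℝ) else -1 with hg
  change |∑ x : F, g (a * x + b * x⁻¹)| ≤ _ at hK
  change _ ≤ (2 : ℝ) ^ (2 * m - 1) - (1 / 2) * |∑ x : F, g (a * x + b * f x)|
  have hg1 : ∀ z, |g z| ≤ 1 := by
    intro z; simp only [hg]; split_ifs <;> simp
  have hdiff : |∑ x : F, g (a * x + b * f x) - ∑ x : F, g (a * x + b * x⁻¹)| ≤ 2 * S.ncard := by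
    rw [← Finset.sum_sub_distrib]
    refine (Finset.abs_sum_le_sum_abs _ _).trans ?_
    have : ∀ x ∈ Finset.univ, |g (a * x + b * f x) - g (a * x + b * x⁻¹)|
        ≤ 2 * (if x ∈ S then (1:ℝ) else 0) := by
      intro x _
      by_cases hx : x ∈ S
      · have h1 := hg1 (a * x + b * f x)
        have h2 := hg1 (a * x + b * x⁻¹)
        rw [if_pos hx]
        rw [abs_le] at *
        constructor <;> linarith [h1.1, h1.2, h2.1, h2.2]
      · simp [hf, hx]
    refine (Finset.sum_le_sum this).trans ?_
    rw [← Finset.mul_sum, Finset.sum_boole, Set.ncard_eq_toFinset_card']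
    apply le_of_eq
    congr 3
    ext x; simp
  have h3 := abs_sub_abs_le_abs_sub (∑ x : F, g (a * x + b * f x)) (∑ x : F, g (a * x + b * x⁻¹))
  linarith
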